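/- arXiv:1401.2294 — 3 statements merged into one kernel-verified Lean document; each statement's English description precedes it below -/
import Mathlib

section
/- Let S and R be finite alphabets, let X ⊆ S^{ℤ²} be a countably covered sofic shift, and let Y ⊆ (S × R)^{ℤ²} be an SFT. If the subshift Y ∩ (X × R^{ℤ²}) (the set of configurations of Y whose first component lies in X) is countable, then it is a countably covered sofic shift. -/
namespace QE

/-- A finite pattern over the alphabet `S` on the group of positions `V`:
a finite domain `D ⊆ V` together with an assignment of symbols to `D`. -/
def Pattern (V S : Type*) : Type _ :=
  Σ D : Finset V, {v : V // v ∈ D} → S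

variable {V S T : Type*}

/-- The pattern `P` occurs in the configuration `x` (at some translate). -/
def occursIn [Add V] (P : Pattern V S) (x : V → S) : Prop :=
  ∃ t : V, ∀ w : {v : V // v ∈ P.1}, x (t + w.1) = P.2 w

/-- The subshift defined by the set `F` of forbidden patterns. -/
def shiftOf [Add V] (F : Set (Pattern V S)) : Set (V → S) :=
  {x | ∀ P ∈ F, ¬ occursIn P x}

/-- `X` is a subshift: it is defined by some set of forbidden patterns. -/
def IsSubshift [Add V] (X : Set (V → S)) : Prop :=
  ∃ F : Set (Pattern V S), X = shiftOf F

/-- `X` is a subshift of finite type: defined by a finite set of forbidden patterns. -/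
def IsSFT [Add V] (X : Set (V → S)) : Prop :=
  ∃ F : Set (Pattern V S), F.Finite ∧ X = shiftOf F

/-- The language of `X`: all finite patterns occurring in some configuration of `X`. -/
def lang [Add V] (X : Set (V → S)) : Set (Pattern V S) :=
  {P | ∃ x ∈ X, occursIn P x}

/-- `φ` acts on `Z` as a block map: it is given by a local function on a finite neighborhood. -/
def IsBlockMapOn [Add V] (Z : Set (V → S)) (φ : (V → S) → V → T) : Prop :=
  ∃ (D : Finset V) (Φ : ({v : V // v ∈ D} → S) → T),
    ∀ x ∈ Z, ∀ t : V, φ x t = Φ fun w => x (t + w.1)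

/-- `X` is a sofic shift: the image of an SFT (over some finite alphabet) under a block map. -/
def IsSofic [Add V] (X : Set (V → S)) : Prop :=
  ∃ (T' : Type) (_ : Fintype T') (Z : Set (V → T')) (φ : (V → T') → V → S),
    IsSFT Z ∧ IsBlockMapOn Z φ ∧ φ '' Z = X

/-- `X` is a countably covered sofic shift: the image of a countable SFT under a block map. -/
def IsCountablyCovered [Add V] (X : Set (V → S)) : Prop :=
  ∃ (T' : Type) (_ : Fintype T') (Z : Set (V → T')) (φ : (V → T') → V → S),
    IsSFT Z ∧ Z.Countable ∧ IsBlockMapOn Z φ ∧ φ '' Z = X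

/-- Fill the holes (`none`-symbols) of the pattern `P` using the pattern `Q`:
this is `P^{(Q)}`. -/
def fill (P : Pattern V (Option S)) (Q : {v : V // v ∈ P.1} → S) : Pattern V S :=
  ⟨P.1, fun w => (P.2 w).getD (Q w)⟩

/-- The universal extension `A(X,Y)`, a subshift over the alphabet `Option S`
(`none` playing the role of the hole symbol `□`). -/
def univExt [Add V] (X Y : Set (V → S)) : Set (V → Option S) :=
  shiftOf {P : Pattern V (Option S) |
    ∃ Q : {v : V // v ∈ P.1} → S, (⟨P.1, Q⟩ : Pattern V S) ∈ lang Y ∧ fill P Q ∉ lang X}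

/-- The existential extension `E(X,Y)`, a subshift over the alphabet `Option S`
(`none` playing the role of the hole symbol `□`). -/
def existExt [Add V] (X Y : Set (V → S)) : Set (V → Option S) :=
  shiftOf {P : Pattern V (Option S) |
    ∀ Q : {v : V // v ∈ P.1} → S, (⟨P.1, Q⟩ : Pattern V S) ∈ lang Y → fill P Q ∉ lang X}


/-- Patterns with a common domain over a finite alphabet form a finite set. -/
theorem finite_range_pattern [Finite S] (D : Finset V) :
    (Set.range fun q : {v : V // v ∈ D} → S => (⟨D, q⟩ : Pattern V S)).Finite :=
  Set.finite_range _

theorem IsSFT.inter [Add V] {X Y : Set (V → S)} (hX : IsSFT X) (hY : IsSFT Y) :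
    IsSFT (X ∩ Y) := by
  obtain ⟨F, hF, rfl⟩ := hX
  obtain ⟨G, hG, rfl⟩ := hY
  refine ⟨F ∪ G, hF.union hG, ?_⟩
  ext x
  simp only [shiftOf, Set.mem_inter_iff, Set.mem_ofPred_eq, Set.mem_union, or_imp, forall_and]

/-- The preimage of an SFT under a symbol-to-symbol map is an SFT. -/
theorem IsSFT.preimage_comp [Add V] [Finite T] {X : Set (V → S)} (hX : IsSFT X) (f : T → S) :
    IsSFT {y : V → T | (fun v => f (y v)) ∈ X} := by
  obtain ⟨F, hF, rfl⟩ := hX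
  refine ⟨{P : Pattern V T | (⟨P.1, fun w => f (P.2 w)⟩ : Pattern V S) ∈ F}, ?_, ?_⟩
  · refine (hF.biUnion fun P _ => finite_range_pattern (S := T) P.1).subset ?_
    intro P hP
    exact Set.mem_biUnion hP ⟨P.2, rfl⟩
  · ext y
    constructor
    · rintro hy P hP ⟨t, ht⟩
      exact hy _ hP ⟨t, fun w => congrArg f (ht w)⟩
    · rintro hy ⟨D, p⟩ hP ⟨t, ht⟩
      refine hy ⟨D, fun w => y (t + w.1)⟩ ?_ ⟨t, fun w => rfl⟩
      have hp : (fun w : {v : V // v ∈ D} => f (y (t + w.1))) = p := funext ht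
      change (⟨D, fun w => f (y (t + w.1))⟩ : Pattern V S) ∈ F
      rwa [hp]

/-- Prescribing the patterns allowed on a finite window defines an SFT. -/
theorem isSFT_of_window [Add V] [Finite S] (E : Finset V) (A : Set ({v : V // v ∈ E} → S)) :
    IsSFT {x : V → S | ∀ t, (fun w : {v : V // v ∈ E} => x (t + w.1)) ∈ A} := by
  refine ⟨(fun q => (⟨E, q⟩ : Pattern V S)) '' Aᶜ, (Set.toFinite Aᶜ).image _, ?_⟩
  ext x
  constructor
  · rintro hx _ ⟨q, hq, rfl⟩ ⟨t, ht⟩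
    exact hq ((funext ht : (fun w : {v : V // v ∈ E} => x (t + w.1)) = q) ▸ hx t)
  · intro hx t
    by_contra h
    exact hx _ ⟨_, h, rfl⟩ ⟨t, fun _ => rfl⟩

/-- The graph-like condition that one coordinate is computed from another by a local rule
defines an SFT. -/
theorem isSFT_local_rule {U : Type*} [AddZeroClass V] [Finite U] (D : Finset V)
    (Φ : ({v : V // v ∈ D} → S) → T) (f : U → S) (g : U → T) :
    IsSFT {x : V → U | ∀ t, Φ (fun w => f (x (t + w.1))) = g (x t)} := by
  classical
  convert isSFT_of_window (S := U) (insert 0 D)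
    {q | Φ (fun w => f (q ⟨w.1, Finset.mem_insert_of_mem w.2⟩)) =
      g (q ⟨0, Finset.mem_insert_self 0 D⟩)} using 4 with x
  simp

/-- Let `X ⊆ S^{ℤ²}` be a countably covered sofic shift and let
`Y ⊆ (S × R)^{ℤ²}` be an SFT. If `Y ∩ (X × R^{ℤ²})` (the configurations of `Y` whose
first component lies in `X`) is countable, then it is a countably covered sofic shift. -/
theorem stmt12 (S R : Type) [Fintype S] [Fintype R]
    (X : Set ((ℤ × ℤ) → S)) (hX : IsCountablyCovered X)
    (Y : Set ((ℤ × ℤ) → S × R)) (hY : IsSFT Y)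
    (hcnt : (Y ∩ {z | (fun v => (z v).1) ∈ X}).Countable) :
    IsCountablyCovered (Y ∩ {z | (fun v => (z v).1) ∈ X}) := by
  obtain ⟨U, _, Z, φ, hZ, hZc, ⟨D, Φ, hΦ⟩, rfl⟩ := hX
  refine ⟨U × S × R, inferInstance,
    ({w | (fun v => (w v).1) ∈ Z} ∩ {w | (fun v => (w v).2) ∈ Y}) ∩
      {w | ∀ t, Φ (fun d => (w (t + d.1)).1) = (w t).2.1},
    fun w v => (w v).2,
    ((hZ.preimage_comp Prod.fst).inter (hY.preimage_comp Prod.snd)).inter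
      (isSFT_local_rule D Φ Prod.fst fun u : U × S × R => u.2.1), ?_,
    ⟨{0}, fun q => (q ⟨0, Finset.mem_singleton_self 0⟩).2, fun w _ t => by simp⟩, ?_⟩
  · refine Set.MapsTo.countable_of_injOn
      (f := fun w => ((fun v => (w v).1), fun v => (w v).2)) ?_ ?_ (hZc.prod hcnt)
    · rintro w ⟨⟨hz, hy⟩, hw⟩
      exact ⟨hz, hy, _, hz, funext fun t => (hΦ _ hz t).trans (hw t)⟩
    · intro w _ w' _ h
      exact funext fun v =>
        Prod.ext (congrFun (congrArg Prod.fst h) v) (congrFun (congrArg Prod.snd h) v)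
  · ext y
    constructor
    · rintro ⟨w, ⟨⟨hz, hy⟩, hw⟩, rfl⟩
      exact ⟨hy, _, hz, funext fun t => (hΦ _ hz t).trans (hw t)⟩
    · rintro ⟨hy, z, hz, hzy⟩
      exact ⟨fun v => (z v, y v),
        ⟨⟨hz, hy⟩, fun t => (hΦ z hz t).symm.trans (congrFun hzy t)⟩, rfl⟩

end QE
end

section
/- Let X ⊆ S^{ℤ²} be a sofic shift. Then there exists C > 0 such that for every n ≥ 1 and every subset Λ ⊆ X with |Λ| ≥ C^n + 1, there exist distinct x, y ∈ Λ with c(x,y,n) ∈ X, where c(x,y,n) ∈ S^{ℤ²} is the configuration defined by c(x,y,n)_v = x_v for v ∈ [0,n−1]² and c(x,y,n)_v = y_v for v ∈ ℤ² \ [0,n−1]². -/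
namespace QE

variable {V S T : Type*}

/-- The configuration `c(x,y,n)` agreeing with `x` on the square `[0,n-1]²` and
with `y` elsewhere. -/
def glue {S : Type*} (x y : (ℤ × ℤ) → S) (n : ℕ) : (ℤ × ℤ) → S := fun v =>
  if 0 ≤ v.1 ∧ v.1 ≤ (n : ℤ) - 1 ∧ 0 ≤ v.2 ∧ v.2 ≤ (n : ℤ) - 1 then x v else y v

/-- A finite set of positions is contained in a square centered at the origin. -/
theorem exists_abs_le_of_finset (E : Finset (ℤ × ℤ)) :
    ∃ R : ℕ, ∀ w ∈ E, |w.1| ≤ (R : ℤ) ∧ |w.2| ≤ (R : ℤ) := by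
  refine ⟨E.sup fun w => max w.1.natAbs w.2.natAbs, fun w hw => ?_⟩
  have h := Finset.le_sup (f := fun w : ℤ × ℤ => max w.1.natAbs w.2.natAbs) hw
  simp only [max_le_iff] at h
  rw [Int.abs_eq_natAbs, Int.abs_eq_natAbs]
  exact ⟨Int.ofNat_le.2 h.1, Int.ofNat_le.2 h.2⟩

/-- The positions within distance about `R` of the boundary of `[0,n-1]²`. -/
noncomputable def squareBorder (R n : ℕ) : Finset (ℤ × ℤ) :=
  (Finset.Ico (-R : ℤ) R ∪ Finset.Ico ((n : ℤ) - R) (n + R)) ×ˢ Finset.Ico (-R : ℤ) (n + R) ∪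
    Finset.Ico (-R : ℤ) (n + R) ×ˢ (Finset.Ico (-R : ℤ) R ∪ Finset.Ico ((n : ℤ) - R) (n + R))

theorem card_squareBorder_le {R n : ℕ} (hn : 1 ≤ n) :
    (squareBorder R n).card ≤ 8 * R * (1 + 2 * R) * n := by
  have hs : (Finset.Ico (-R : ℤ) R ∪ Finset.Ico ((n : ℤ) - R) (n + R)).card ≤ 4 * R := by
    refine (Finset.card_union_le _ _).trans ?_
    simp only [Int.card_Ico]
    omega
  have hl : (Finset.Ico (-R : ℤ) (n + R)).card ≤ (1 + 2 * R) * n := by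
    have : (Finset.Ico (-R : ℤ) (n + R)).card = n + 2 * R := by
      simp only [Int.card_Ico]
      omega
    rw [this]
    nlinarith
  refine (Finset.card_union_le _ _).trans ?_
  rw [Finset.card_product, Finset.card_product]
  have := Nat.mul_le_mul hs hl
  linarith

/-- If `x` and `y` agree near the boundary of the square, then the window of their gluing
around a position is the window of whichever of the two the gluing follows at that position. -/
theorem glue_add_eq {A : Type*} {R n : ℕ} {x y : ℤ × ℤ → A}
    (h : ∀ v ∈ squareBorder R n, x v = y v) {t w : ℤ × ℤ}
    (h₁ : |w.1| ≤ (R : ℤ)) (h₂ : |w.2| ≤ (R : ℤ)) :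
    glue x y n (t + w) = glue (fun _ => x) (fun _ => y) n t (t + w) := by
  have hb := h (t + w)
  simp only [squareBorder, Finset.mem_union, Finset.mem_product, Finset.mem_Ico, Prod.fst_add,
    Prod.snd_add] at hb
  rw [abs_le] at h₁ h₂
  simp only [glue, Prod.fst_add, Prod.snd_add]
  split_ifs with hs ht ht
  · rfl
  · exact hb (by omega)
  · exact (hb (by omega)).symm
  · rfl

/-- Gluing preserves membership in a subshift whose forbidden patterns have small domains, for
configurations agreeing near the boundary of the square. -/
theorem glue_mem_shiftOf {A : Type*} {R n : ℕ} {F : Set (Pattern (ℤ × ℤ) A)}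
    (hF : ∀ P ∈ F, ∀ w ∈ P.1, |w.1| ≤ (R : ℤ) ∧ |w.2| ≤ (R : ℤ)) {x y : ℤ × ℤ → A}
    (hx : x ∈ shiftOf F) (hy : y ∈ shiftOf F) (h : ∀ v ∈ squareBorder R n, x v = y v) :
    glue x y n ∈ shiftOf F := by
  rintro P hP ⟨t, ht⟩
  have key : ∀ w : {v // v ∈ P.1}, glue (fun _ => x) (fun _ => y) n t (t + w.1) = P.2 w :=
    fun w => (glue_add_eq h (hF P hP w w.2).1 (hF P hP w w.2).2).symm.trans (ht w)
  unfold glue at key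
  split_ifs at key
  · exact hx P hP ⟨t, key⟩
  · exact hy P hP ⟨t, key⟩

/-- For every sofic shift `X ⊆ S^{ℤ²}` there is `C > 0` such that for
all `n ≥ 1` and all `Λ ⊆ X` with `|Λ| ≥ C^n + 1`, there are distinct `x, y ∈ Λ` with
`c(x,y,n) ∈ X`. -/
theorem stmt13 (S : Type) [Fintype S] (X : Set ((ℤ × ℤ) → S)) (hX : IsSofic X) :
    ∃ C : ℕ, 0 < C ∧ ∀ n : ℕ, 1 ≤ n → ∀ Λ : Set ((ℤ × ℤ) → S), Λ ⊆ X →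
      ((C ^ n + 1 : ℕ) : ℕ∞) ≤ Λ.encard →
      ∃ x ∈ Λ, ∃ y ∈ Λ, x ≠ y ∧ glue x y n ∈ X := by
  classical
  obtain ⟨T, _, Z, φ, ⟨F, hF, rfl⟩, ⟨D, Φ, hΦ⟩, rfl⟩ := hX
  obtain ⟨R, hR⟩ := exists_abs_le_of_finset (D ∪ hF.toFinset.biUnion fun P => P.1)
  have hRD : ∀ w ∈ D, |w.1| ≤ (R : ℤ) ∧ |w.2| ≤ (R : ℤ) :=
    fun w hw => hR w (Finset.mem_union_left _ hw)
  have hRF : ∀ P ∈ F, ∀ w ∈ P.1, |w.1| ≤ (R : ℤ) ∧ |w.2| ≤ (R : ℤ) := fun P hP w hw =>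
    hR w (Finset.mem_union_right _ (Finset.mem_biUnion.2 ⟨P, hF.mem_toFinset.2 hP, hw⟩))
  refine ⟨(Fintype.card T + 1) ^ (8 * R * (1 + 2 * R)), by positivity, fun n hn Λ hΛ hcard => ?_⟩
  have hne : Λ.Nonempty := by
    rw [← Set.encard_pos]
    exact lt_of_lt_of_le (by exact_mod_cast Nat.succ_pos _) hcard
  have : Nonempty (ℤ × ℤ → T) := let ⟨z, _⟩ := hΛ hne.some_mem; ⟨z⟩
  have hpre : ∀ x : ℤ × ℤ → S, ∃ z : ℤ × ℤ → T, x ∈ Λ → z ∈ shiftOf F ∧ φ z = x := fun x =>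
    if hx : x ∈ Λ then (hΛ hx).imp fun _ hz _ => hz else ⟨Classical.arbitrary _, (absurd · hx)⟩
  choose g hg using hpre
  obtain ⟨Λ', hΛ', hcard'⟩ := Set.exists_subset_encard_eq hcard
  have hfin : Λ'.Finite := Set.finite_of_encard_eq_coe hcard'
  rw [hfin.encard_eq_coe_toFinset_card, Nat.cast_inj] at hcard'
  let border : (ℤ × ℤ → S) → ({v // v ∈ squareBorder R n} → T) := fun x v => g x v
  have hlt : (Finset.univ : Finset ({v // v ∈ squareBorder R n} → T)).card <
      hfin.toFinset.card := by
    rw [hcard', Finset.card_univ, Fintype.card_fun, Fintype.card_coe, Nat.lt_succ_iff, ← pow_mul]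
    exact (Nat.pow_le_pow_left (Nat.le_succ _) _).trans
      (Nat.pow_le_pow_right (Nat.succ_pos _) (card_squareBorder_le hn))
  obtain ⟨x, hx, y, hy, hxy, hb⟩ := Finset.exists_ne_map_eq_of_card_lt_of_maps_to hlt
    (f := border) fun _ _ => Finset.mem_coe.2 (Finset.mem_univ _)
  have hxΛ := hΛ' (hfin.mem_toFinset.1 hx)
  have hyΛ := hΛ' (hfin.mem_toFinset.1 hy)
  have hagree : ∀ v ∈ squareBorder R n, g x v = g y v := fun v hv => congrFun hb ⟨v, hv⟩
  have hmem := glue_mem_shiftOf hRF (hg x hxΛ).1 (hg y hyΛ).1 hagree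
  refine ⟨x, hxΛ, y, hyΛ, hxy, glue (g x) (g y) n, hmem, funext fun t => ?_⟩
  rw [hΦ _ hmem t]
  simp_rw [fun w : {v // v ∈ D} => glue_add_eq (t := t) hagree (hRD w w.2).1 (hRD w w.2).2]
  conv_rhs => rw [← (hg x hxΛ).2, ← (hg y hyΛ).2]
  unfold glue
  split_ifs
  · exact (hΦ _ (hg x hxΛ).1 t).symm
  · exact (hΦ _ (hg y hyΛ).1 t).symm

end QE
end

section
/- Let X ⊆ S^{ℤ²} be a downward deterministic subshift and let Y ⊆ S^{ℤ²} be any subshift. If A(X,Y) ≠ X (i.e., the universal extension is not contained in configurations over S alone), then Y is downward deterministic. -/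
namespace QE

variable {V S T : Type*}

/-- A two-dimensional subshift is downward deterministic if the contents of the open
upper half-plane `{(a,b) : b > 0}` determine the symbol at the origin. -/
def DownDet {S : Type*} (X : Set ((ℤ × ℤ) → S)) : Prop :=
  ∀ x ∈ X, ∀ y ∈ X, (∀ v : ℤ × ℤ, 0 < v.2 → x v = y v) → x (0, 0) = y (0, 0)

/-- Filling the holes of a translate of a configuration of the universal extension with a
configuration of `Y` gives a configuration of `X`. -/
theorem getD_mem_of_mem_univExt {V S : Type*} [AddSemigroup V] {X Y : Set (V → S)}
    (hX : IsSubshift X) {z : V → Option S} (hz : z ∈ univExt X Y) (v : V)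
    {y : V → S} (hy : y ∈ Y) : (fun u => (z (v + u)).getD (y u)) ∈ X := by
  obtain ⟨F, rfl⟩ := hX
  rintro P hP ⟨t, ht⟩
  refine hz ⟨P.1, fun w => z (v + t + w.1)⟩ ⟨fun w => y (t + w.1), ⟨y, hy, t, fun _ => rfl⟩, ?_⟩
    ⟨v + t, fun _ => rfl⟩
  rintro ⟨x, hx, s, hs⟩
  refine hx P hP ⟨s, fun w => (hs w).trans (Eq.trans ?_ (ht w))⟩
  simp only [fill, add_assoc]

/-- If `X ⊆ S^{ℤ²}` is a downward deterministic subshift, `Y ⊆ S^{ℤ²}`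
is any subshift, and `A(X,Y) ≠ X` (i.e. some configuration of the universal extension
contains the hole symbol `□`), then `Y` is downward deterministic. -/
theorem stmt16 (S : Type) [Fintype S] (X Y : Set ((ℤ × ℤ) → S))
    (hXsub : IsSubshift X) (hYsub : IsSubshift Y) (hXdet : DownDet X)
    (hne : ∃ z ∈ univExt X Y, ∃ v : ℤ × ℤ, z v = none) :
    DownDet Y := by
  obtain ⟨z, hz, v, hv⟩ := hne
  intro x hx y hy hxy
  have h := hXdet _ (getD_mem_of_mem_univExt hXsub hz v hx)
    _ (getD_mem_of_mem_univExt hXsub hz v hy) fun u hu => by simp only [hxy u hu]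
  have hv' : z (v + (0, 0)) = none := (congrArg z (add_zero v)).trans hv
  simpa only [hv', Option.getD_none] using h

end QE
end
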